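/- If G is a finite graph such that every subgraph H of G satisfies |E(H)| <= (14|V(H)| + 5)/9, then V(G) can be partitioned into sets V1 and V2 such that every vertex of V1 has at most 1 neighbor in V1, and every vertex of V2 has at most 3 neighbors in V2. -/

import Mathlib

/-- G is (1,3)-colorable: V(G) partitions into V1 (f = true) inducing max degree ≤ 1
and V2 (f = false) inducing max degree ≤ 3. -/
def Colorable13 {V : Type*} (G : SimpleGraph V) : Prop :=
  ∃ f : V → Bool,
    (∀ v, f v = true → (G.neighborSet v ∩ {u | f u = true}).ncard ≤ 1) ∧
    (∀ v, f v = false → (G.neighborSet v ∩ {u | f u = false}).ncard ≤ 3)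

namespace DefectiveColoring

open Finset
open scoped Classical

variable {V : Type*} {G G' : SimpleGraph V} {a a' b b' : V → ℕ} {S A U : Finset V}

/-- The number of neighbours of `v` in `S`. -/
noncomputable def degIn (G : SimpleGraph V) (S : Finset V) (v : V) : ℕ :=
  #{u ∈ S | G.Adj v u}

/-- The number of edges of `G` inside `S`. -/
noncomputable def edgesIn (G : SimpleGraph V) (S : Finset V) : ℕ :=
  (∑ v ∈ S, degIn G S v) / 2

/-- The potential of a vertex that tolerates fewer than `x` neighbours of its own color when
colored `true`, and fewer than `y` when colored `false`. -/
def weight (x y : ℕ) : ℤ := 4 * (x : ℤ) + 3 * ((max y 1 : ℕ) : ℤ) - 6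

/-- The potential of a set of vertices. -/
noncomputable def potential (G : SimpleGraph V) (a b : V → ℕ) (S : Finset V) : ℤ :=
  ∑ v ∈ S, weight (a v) (b v) - 9 * edgesIn G S

/-- `f` colors `S` so that each vertex `v` has fewer than `a v` (if colored `true`) or `b v`
(if colored `false`) neighbours of its own color. -/
def IsColoring (G : SimpleGraph V) (a b : V → ℕ) (S : Finset V) (f : V → Bool) : Prop :=
  ∀ v ∈ S, #{u ∈ S | G.Adj v u ∧ f u = f v} < bif f v then a v else b v

/-- The sparsity assumption under which a coloring is shown to exist. -/
structure Admissible (G : SimpleGraph V) (a b : V → ℕ) (S : Finset V) : Prop where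
  a_le : ∀ v ∈ S, a v ≤ 2
  b_le : ∀ v ∈ S, b v ≤ 4
  le_potential : ∀ A ⊆ S, A.Nonempty → -5 ≤ potential G a b A
  forced : ∀ v ∈ S, b v = 0 → #{u ∈ S | G.Adj v u ∧ b u = 0} < a v

/-! ### Counting edges -/

lemma degIn_insert {x : V} (hx : x ∉ S) (v : V) :
    degIn G (insert x S) v = degIn G S v + if G.Adj v x then 1 else 0 := by
  unfold degIn
  rw [filter_insert]
  split_ifs
  · rw [card_insert_of_notMem (by simp [hx])]
  · rfl

lemma degIn_union (h : Disjoint S A) (v : V) :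
    degIn G (S ∪ A) v = degIn G S v + degIn G A v := by
  unfold degIn
  rw [filter_union, card_union_of_disjoint (disjoint_filter_filter h)]

lemma degIn_mono (h : A ⊆ S) (v : V) : degIn G A v ≤ degIn G S v :=
  card_le_card (filter_subset_filter _ h)

lemma sum_degIn_insert {x : V} (hx : x ∉ S) :
    ∑ v ∈ insert x S, degIn G (insert x S) v = ∑ v ∈ S, degIn G S v + 2 * degIn G S x := by
  rw [sum_insert hx]
  simp only [degIn_insert hx, SimpleGraph.irrefl, if_false, sum_add_distrib]
  have : ∑ v ∈ S, (if G.Adj v x then 1 else 0) = degIn G S x := by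
    unfold degIn
    rw [card_filter]
    exact sum_congr rfl fun v _ => by simp [G.adj_comm]
  omega

lemma even_sum_degIn (S : Finset V) : Even (∑ v ∈ S, degIn G S v) := by
  induction S using Finset.induction_on with
  | empty => simp
  | insert x S hx ih => rw [sum_degIn_insert hx]; exact ih.add (even_two_mul _)

lemma two_mul_edgesIn (S : Finset V) : 2 * edgesIn G S = ∑ v ∈ S, degIn G S v :=
  Nat.two_mul_div_two_of_even (even_sum_degIn S)

lemma edgesIn_insert {x : V} (hx : x ∉ S) :
    edgesIn G (insert x S) = edgesIn G S + degIn G S x := by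
  have h1 := two_mul_edgesIn (G := G) (insert x S)
  have h2 := two_mul_edgesIn (G := G) S
  rw [sum_degIn_insert hx] at h1
  omega

lemma edgesIn_union (h : Disjoint S A) :
    edgesIn G (S ∪ A) = edgesIn G S + edgesIn G A + ∑ v ∈ A, degIn G S v := by
  induction A using Finset.induction_on with
  | empty => simp [edgesIn]
  | insert x A hx ih =>
    rw [disjoint_insert_right] at h
    have hx' : x ∉ S ∪ A := by simp [h.1, hx]
    rw [union_insert, edgesIn_insert hx', edgesIn_insert hx, ih h.2, sum_insert hx,
      degIn_union h.2]
    ring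

lemma edgesIn_mono (h : A ⊆ S) : edgesIn G A ≤ edgesIn G S := by
  rw [← union_sdiff_of_subset h, edgesIn_union disjoint_sdiff]
  omega

lemma degIn_congr {v : V} (h : ∀ u ∈ S, G.Adj v u ↔ G'.Adj v u) :
    degIn G S v = degIn G' S v := by
  unfold degIn
  rw [filter_congr h]

lemma edgesIn_congr (h : ∀ v ∈ S, ∀ u ∈ S, G.Adj v u ↔ G'.Adj v u) :
    edgesIn G S = edgesIn G' S := by
  unfold edgesIn
  rw [sum_congr rfl fun v hv => degIn_congr (h v hv)]

lemma edgesIn_deleteEdges {x y : V} (hxy : G.Adj x y) (S : Finset V) :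
    edgesIn G S = edgesIn (G.deleteEdges {s(x, y)}) S + if x ∈ S ∧ y ∈ S then 1 else 0 := by
  split_ifs with h
  · obtain ⟨hx, hy⟩ := h
    have hxe : x ∉ S.erase x := by simp
    have hye : y ∉ (S.erase x).erase y := by simp
    have hS : insert x (insert y ((S.erase x).erase y)) = S := by
      rw [insert_erase (mem_erase.2 ⟨hxy.ne', hy⟩), insert_erase hx]
    have hx' : x ∉ insert y ((S.erase x).erase y) := by simp [hxy.ne]
    rw [← hS, edgesIn_insert hx', edgesIn_insert hye, edgesIn_insert hx', edgesIn_insert hye,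
      degIn_insert hye, degIn_insert hye]
    have h0 : edgesIn G ((S.erase x).erase y)
        = edgesIn (G.deleteEdges {s(x, y)}) ((S.erase x).erase y) := by
      refine edgesIn_congr fun v hv u hu => ?_
      simp only [mem_erase] at hv hu
      simp only [SimpleGraph.deleteEdges_adj, Set.mem_singleton_iff, Sym2.eq_iff]
      tauto
    have h1 : degIn (G.deleteEdges {s(x, y)}) ((S.erase x).erase y) x
        = degIn G ((S.erase x).erase y) x := by
      refine degIn_congr fun u hu => ?_
      simp only [mem_erase] at hu
      simp only [SimpleGraph.deleteEdges_adj, Set.mem_singleton_iff, Sym2.eq_iff]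
      tauto
    have h2 : degIn (G.deleteEdges {s(x, y)}) ((S.erase x).erase y) y
        = degIn G ((S.erase x).erase y) y := by
      refine degIn_congr fun u hu => ?_
      simp only [mem_erase] at hu
      simp only [SimpleGraph.deleteEdges_adj, Set.mem_singleton_iff, Sym2.eq_iff]
      tauto
    simp [h0, h1, h2, hxy]
    ring
  · refine edgesIn_congr fun v hv u hu => ?_
    simp only [SimpleGraph.deleteEdges_adj, Set.mem_singleton_iff, Sym2.eq_iff]
    constructor
    · intro hvu
      refine ⟨hvu, ?_⟩
      rintro (⟨rfl, rfl⟩ | ⟨rfl, rfl⟩)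
      · exact h ⟨hv, hu⟩
      · exact h ⟨hu, hv⟩
    · exact fun h => h.1

/-! ### Potentials -/

lemma potential_insert {x : V} (hx : x ∉ S) :
    potential G a b (insert x S) = potential G a b S + weight (a x) (b x) - 9 * degIn G S x := by
  unfold potential
  rw [sum_insert hx, edgesIn_insert hx]
  push_cast
  ring

lemma potential_union (h : Disjoint S A) :
    potential G a b (S ∪ A) = potential G a b S + potential G a b A
      - 9 * ∑ v ∈ A, (degIn G S v : ℤ) := by
  unfold potential
  rw [sum_union h, edgesIn_union h]
  push_cast
  ring

lemma potential_singleton (v : V) : potential G a b {v} = weight (a v) (b v) := by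
  simp [potential, edgesIn, degIn, filter_singleton]

lemma potential_eq_add_sum (A : Finset V) :
    potential G a b A = potential G a' b' A
      + ∑ v ∈ A, (weight (a v) (b v) - weight (a' v) (b' v)) := by
  unfold potential
  rw [sum_sub_distrib]
  ring

lemma Admissible.mono (h : Admissible G a b S) (hA : A ⊆ S) : Admissible G a b A where
  a_le v hv := h.a_le v (hA hv)
  b_le v hv := h.b_le v (hA hv)
  le_potential B hB := h.le_potential B (hB.trans hA)
  forced v hv hb := (card_le_card (filter_subset_filter _ hA)).trans_lt (h.forced v (hA hv) hb)

/-- `A` consists of vertices that must be colored `true`, and has a vertex `c` adjacent to all the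
others for which these are too many. -/
structure IsObstruction (G : SimpleGraph V) (a b : V → ℕ) (A : Finset V) (c : V) : Prop where
  mem : c ∈ A
  b_eq_zero : ∀ v ∈ A, b v = 0
  adj : ∀ v ∈ A, v ≠ c → G.Adj c v
  card_eq : #A = a c + 1

lemma IsObstruction.potential_le {c : V} (h : IsObstruction G a b A c) :
    potential G a b A ≤ -3 + ∑ v ∈ A.erase c, 4 * ((a v : ℤ) - 2) := by
  have hc : c ∉ A.erase c := by simp
  have hd : degIn G (A.erase c) c = a c := by
    unfold degIn
    rw [filter_true_of_mem fun v hv => h.adj v (mem_of_mem_erase hv) (ne_of_mem_erase hv),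
      card_erase_of_mem h.mem, h.card_eq]
    simp
  have hs : ∑ v ∈ A.erase c, weight (a v) (b v)
      = ∑ v ∈ A.erase c, 4 * ((a v : ℤ) - 2) + 5 * a c := by
    have : ∀ v ∈ A.erase c, weight (a v) (b v) = 4 * ((a v : ℤ) - 2) + 5 := fun v hv => by
      rw [h.b_eq_zero v (mem_of_mem_erase hv)]
      simp [weight]
      ring
    rw [sum_congr rfl this, sum_add_distrib, sum_const, card_erase_of_mem h.mem, h.card_eq]
    simp
    ring
  rw [← insert_erase h.mem, potential_insert hc, hd, h.b_eq_zero c h.mem]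
  unfold potential
  rw [hs]
  simp only [erase_insert hc]
  simp [weight]
  have : (0 : ℤ) ≤ edgesIn G (A.erase c) := by positivity
  linarith

lemma IsObstruction.potential_le_neg_three {c : V} (h : IsObstruction G a b A c)
    (ha : ∀ v ∈ A, a v ≤ 2) : potential G a b A ≤ -3 := by
  refine h.potential_le.trans ?_
  have : ∑ v ∈ A.erase c, 4 * ((a v : ℤ) - 2) ≤ 0 := sum_nonpos fun v hv => by
    have := ha v (mem_of_mem_erase hv)
    omega
  linarith

lemma exists_of_not_admissible (ha : ∀ v ∈ S, a v ≤ 2) (hb : ∀ v ∈ S, b v ≤ 4)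
    (h : ¬ Admissible G a b S) :
    ∃ A ⊆ S, A.Nonempty ∧ (potential G a b A ≤ -6 ∨ ∃ c, IsObstruction G a b A c) := by
  by_contra! hA
  refine h ⟨ha, hb, fun A hAS hne => ?_, fun v hv hbv => ?_⟩
  · have := (hA A hAS hne).1
    omega
  · by_contra! hle
    obtain ⟨T, hT, hTc⟩ := exists_subset_card_eq hle
    have hvT : v ∉ T := fun hvT => by simpa using hT hvT
    have hTm : ∀ u ∈ T, u ∈ S ∧ G.Adj v u ∧ b u = 0 := fun u hu => by simpa using hT hu
    refine (hA (insert v T) ?_ (insert_nonempty _ _)).2 v ⟨mem_insert_self _ _, ?_, ?_, ?_⟩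
    · exact insert_subset hv fun u hu => (hTm u hu).1
    · intro u hu
      rcases mem_insert.1 hu with rfl | hu
      exacts [hbv, (hTm u hu).2.2]
    · intro u hu hne
      exact (hTm u (mem_of_mem_insert_of_ne hu hne)).2.1
    · rw [card_insert_of_notMem hvT, hTc]

/-! ### Minimal counterexamples -/

/-- The quantity on which the induction runs. -/
noncomputable def size (G : SimpleGraph V) (b : V → ℕ) (S : Finset V) : ℕ :=
  #S + edgesIn G S + ∑ v ∈ S, b v

/-- An admissible instance without a coloring, all of whose smaller admissible instances have
colorings. -/
structure IsMinimal (G : SimpleGraph V) (a b : V → ℕ) (U : Finset V) : Prop where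
  admissible : Admissible G a b U
  not_isColoring : ∀ f, ¬ IsColoring G a b U f
  exists_isColoring : ∀ (G' : SimpleGraph V) (a' b' : V → ℕ) (S : Finset V),
    size G' b' S < size G b U → Admissible G' a' b' S → ∃ f, IsColoring G' a' b' S f

lemma IsMinimal.exists_isColoring_of_ssubset (h : IsMinimal G a b U) (hS : S ⊂ U)
    (hb : ∀ v ∈ S, b' v ≤ b v) (hadm : Admissible G a' b' S) :
    ∃ f, IsColoring G a' b' S f := by
  refine h.exists_isColoring G a' b' S ?_ hadm
  have h1 := card_lt_card hS
  have h2 := edgesIn_mono (G := G) hS.1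
  have h3 : ∑ v ∈ S, b' v ≤ ∑ v ∈ U, b v :=
    (sum_le_sum hb).trans (sum_le_sum_of_subset hS.1)
  unfold size
  omega

lemma IsMinimal.not_glue (h : IsMinimal G a b U) (hS : S ⊆ U) (f g : V → Bool)
    (hf : ∀ v ∈ S, #{u ∈ S | G.Adj v u ∧ f u = f v} + #{u ∈ U \ S | G.Adj v u ∧ g u = f v}
      < bif f v then a v else b v)
    (hg : ∀ v ∈ U \ S, #{u ∈ S | G.Adj v u ∧ f u = g v} + #{u ∈ U \ S | G.Adj v u ∧ g u = g v}
      < bif g v then a v else b v) : False := by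
  refine h.not_isColoring (fun v => if v ∈ S then f v else g v) fun v hv => ?_
  have key : ∀ c : Bool, #{u ∈ U | G.Adj v u ∧ (if u ∈ S then f u else g u) = c}
      = #{u ∈ S | G.Adj v u ∧ f u = c} + #{u ∈ U \ S | G.Adj v u ∧ g u = c} := fun c => by
    conv_lhs => rw [← union_sdiff_of_subset hS]
    rw [filter_union, card_union_of_disjoint (disjoint_filter_filter disjoint_sdiff)]
    congr 1
    · exact congrArg card (filter_congr fun u hu => by simp [hu])
    · exact congrArg card (filter_congr fun u hu => by simp [(mem_sdiff.1 hu).2])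
  rw [key]
  by_cases hvS : v ∈ S
  · simpa [hvS] using hf v hvS
  · simpa [hvS] using hg v (mem_sdiff.2 ⟨hv, hvS⟩)

lemma sum_le_of_nonpos_of_mem {F : V → ℤ} {u : V} {c : ℤ} (hF : ∀ v ∈ A, F v ≤ 0) (hu : u ∈ A)
    (hc : F u ≤ c) : ∑ v ∈ A, F v ≤ c := by
  rw [← insert_erase hu, sum_insert (by simp)]
  have := sum_nonpos fun v (hv : v ∈ A.erase u) => hF v (mem_of_mem_erase hv)
  linarith

/-- A proper subset `S` of a minimal counterexample, colored by `f`, lies in a set of much smaller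
potential. The bound improves when the edge `s u` leaves `S` and `s` can tolerate one more
neighbour of its color. -/
lemma IsMinimal.exists_potential_union_le (h : IsMinimal G a b U) (hS : S ⊂ U)
    (hne : S.Nonempty) {f : V → Bool} (hf : IsColoring G a b S f) {s u : V}
    (hsu : u ∈ U \ S → s ∈ S ∧ G.Adj s u ∧
      (f s = false → #{t ∈ S | G.Adj s t ∧ f t = false} + 1 < b s)) :
    ∃ A ⊆ U \ S, A.Nonempty ∧ (potential G a b (S ∪ A) ≤ potential G a b S - 7 ∨
      potential G a b (S ∪ A) ≤ potential G a b S - 3 ∧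
        (u ∈ A → potential G a b (S ∪ A) ≤ potential G a b S - 4 ∧ #A = 1)) := by
  have hlt : U \ S ⊂ U := by
    refine ⟨sdiff_subset, fun hU => ?_⟩
    obtain ⟨x, hx⟩ := hne
    exact (mem_sdiff.1 (hU (hS.1 hx))).2 hx
  set a' : V → ℕ := fun v => if ∃ t ∈ S, G.Adj v t ∧ f t = true then 0 else a v with ha'
  set b' : V → ℕ := fun v => if ∃ t ∈ S, G.Adj v t ∧ f t = false ∧ ¬(v = u ∧ t = s) then 0 else
    if v = u ∧ f s = false then b v - 1 else b v with hb'
  have ha'le : ∀ v, a' v ≤ a v := fun v => by simp only [ha']; split_ifs <;> omega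
  have hb'le : ∀ v, b' v ≤ b v := fun v => by simp only [hb']; split_ifs <;> omega
  have hnot : ¬ Admissible G a' b' (U \ S) := by
    intro hadm
    obtain ⟨g, hg⟩ := h.exists_isColoring_of_ssubset hlt (fun v _ => hb'le v) hadm
    have hgt : ∀ v ∈ U \ S, g v = true → ∀ t ∈ S, G.Adj v t → f t = false := by
      intro v hv hgv t ht hvt
      by_contra hft
      have := hg v hv
      have h0 : a' v = 0 := if_pos ⟨t, ht, hvt, by simpa using hft⟩
      simp [hgv, h0] at this
    have hgf : ∀ v ∈ U \ S, g v = false → ∀ t ∈ S, G.Adj v t → f t = false → v = u ∧ t = s := by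
      intro v hv hgv t ht hvt hft
      by_contra hn
      have := hg v hv
      have h0 : b' v = 0 := if_pos ⟨t, ht, hvt, hft, hn⟩
      simp [hgv, h0] at this
    refine h.not_glue hS.1 f g (fun v hv => ?_) fun v hv => ?_
    · cases hfv : f v
      · by_cases hvs : v = s ∧ u ∈ U \ S
        · obtain ⟨rfl, hu⟩ := hvs
          have h1 := (hsu hu).2.2 hfv
          have h2 : #{w ∈ U \ S | G.Adj v w ∧ g w = false} ≤ 1 := by
            refine (card_le_card (t := {u}) fun w hw => ?_).trans (card_singleton _).le
            simp only [mem_filter] at hw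
            exact mem_singleton.2 (hgf w hw.1 hw.2.2 v hv hw.2.1.symm hfv).1
          simp only [cond_false]
          omega
        · have h1 := hf v hv
          have h2 : #{w ∈ U \ S | G.Adj v w ∧ g w = false} = 0 := by
            rw [card_eq_zero, filter_eq_empty_iff]
            rintro w hw ⟨hvw, hgw⟩
            obtain ⟨rfl, rfl⟩ := hgf w hw hgw v hv hvw.symm hfv
            exact hvs ⟨rfl, hw⟩
          simp only [hfv] at h1
          omega
      · have h1 := hf v hv
        have h2 : #{w ∈ U \ S | G.Adj v w ∧ g w = true} = 0 := by
          rw [card_eq_zero, filter_eq_empty_iff]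
          rintro w hw ⟨hvw, hgw⟩
          have := hgt w hw hgw v hv hvw.symm
          simp [hfv] at this
        simp only [hfv] at h1
        omega
    · have h1 := hg v hv
      cases hgv : g v
      · simp only [hgv, cond_false] at h1 ⊢
        by_cases hvu : v = u ∧ f s = false
        · have h2 : #{t ∈ S | G.Adj v t ∧ f t = false} ≤ 1 := by
            refine (card_le_card (t := {s}) fun t ht => ?_).trans (card_singleton _).le
            simp only [mem_filter] at ht
            exact mem_singleton.2 (hgf v hv hgv t ht.1 ht.2.1 ht.2.2).2
          have h3 : b' v ≤ b v - 1 := by simp only [hb', if_pos hvu]; split_ifs <;> omega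
          omega
        · have h2 : #{t ∈ S | G.Adj v t ∧ f t = false} = 0 := by
            rw [card_eq_zero, filter_eq_empty_iff]
            rintro t ht ⟨hvt, hft⟩
            obtain ⟨rfl, rfl⟩ := hgf v hv hgv t ht hvt hft
            exact hvu ⟨rfl, hft⟩
          have := hb'le v
          omega
      · have h2 : #{t ∈ S | G.Adj v t ∧ f t = true} = 0 := by
          rw [card_eq_zero, filter_eq_empty_iff]
          rintro t ht ⟨hvt, hft⟩
          have := hgt v hv hgv t ht hvt
          simp [hft] at this
        have := ha'le v
        simp only [hgv, cond_true] at h1 ⊢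
        omega
  have hcount : ∀ v ∈ U \ S, #{t ∈ S | G.Adj v t ∧ f t = true}
      + #{t ∈ S | G.Adj v t ∧ f t = false ∧ ¬(v = u ∧ t = s)}
      + (if v = u ∧ f s = false then 1 else 0) ≤ degIn G S v := by
    intro v hv
    have h3 : (if v = u ∧ f s = false then 1 else 0)
        ≤ #{t ∈ S | G.Adj v t ∧ f t = false ∧ (v = u ∧ t = s)} := by
      split_ifs with hvu
      · obtain ⟨rfl, hfs⟩ := hvu
        obtain ⟨hs, hadj, -⟩ := hsu hv
        exact card_pos.2 ⟨s, by simp [hs, hadj.symm, hfs]⟩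
      · omega
    refine (Nat.add_le_add_left h3 _).trans ?_
    rw [← card_union_of_disjoint, ← card_union_of_disjoint]
    · refine card_le_card fun t ht => ?_
      simp only [mem_union, mem_filter] at ht ⊢
      tauto
    · refine disjoint_left.2 fun t ht ht' => ?_
      simp only [mem_union, mem_filter] at ht ht'
      rcases ht with ht | ht
      · simp [ht.2.2] at ht'
      · tauto
    · refine disjoint_left.2 fun t ht ht' => ?_
      simp only [mem_filter] at ht ht'
      simp [ht.2.2] at ht'
  have hapos : ∀ v, (a' v = a v ∨ a' v = 0 ∧ 0 < #{t ∈ S | G.Adj v t ∧ f t = true}) := by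
    intro v
    by_cases hex : ∃ t ∈ S, G.Adj v t ∧ f t = true
    · refine Or.inr ⟨if_pos hex, ?_⟩
      obtain ⟨t, ht⟩ := hex
      exact card_pos.2 ⟨t, by simpa using ht⟩
    · exact Or.inl (if_neg hex)
  have hbpos : ∀ v, (b' v = (if v = u ∧ f s = false then b v - 1 else b v) ∨
      b' v = 0 ∧ 0 < #{t ∈ S | G.Adj v t ∧ f t = false ∧ ¬(v = u ∧ t = s)}) := by
    intro v
    by_cases hex : ∃ t ∈ S, G.Adj v t ∧ f t = false ∧ ¬(v = u ∧ t = s)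
    · refine Or.inr ⟨if_pos hex, ?_⟩
      obtain ⟨t, ht⟩ := hex
      exact card_pos.2 ⟨t, by simpa using ht⟩
    · exact Or.inl (if_neg hex)
  have hslack : ∀ v ∈ U \ S, weight (a v) (b v) - weight (a' v) (b' v) - 9 * degIn G S v ≤ 0 := by
    intro v hv
    have h1 := hcount v hv
    have h2 := h.admissible.a_le v (mem_sdiff.1 hv).1
    have h3 := h.admissible.b_le v (mem_sdiff.1 hv).1
    unfold weight
    rcases hapos v with h4 | h4 <;> rcases hbpos v with h5 | h5 <;> split_ifs at h1 h5 <;> omega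
  have hslack1 : u ∈ U \ S →
      weight (a u) (b u) - weight (a' u) (b' u) - 9 * degIn G S u ≤ -1 := by
    intro hv
    have h1 := hcount u hv
    have h2 := h.admissible.a_le u (mem_sdiff.1 hv).1
    have h3 := h.admissible.b_le u (mem_sdiff.1 hv).1
    obtain ⟨hs, hadj, -⟩ := hsu hv
    unfold weight
    cases hfs : f s
    · simp only [hfs, and_self, if_true] at h1
      have hbu := hbpos u
      simp only [hfs, and_self, if_true] at hbu
      rcases hapos u with h4 | h4 <;> rcases hbu with h5 | h5 <;> omega
    · have : 0 < #{t ∈ S | G.Adj u t ∧ f t = true} :=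
        card_pos.2 ⟨s, by simp [hs, hadj.symm, hfs]⟩
      rcases hapos u with h4 | h4 <;> rcases hbpos u with h5 | h5 <;>
        simp only [hfs, Bool.true_eq_false, and_false, if_false] at h1 h5 <;> omega
  have hslack9 : u ∈ U \ S → f s = false → b' u = 0 →
      weight (a u) (b u) - weight (a' u) (b' u) - 9 * degIn G S u ≤ -9 := by
    intro hv hfs hb0
    have h1 := hcount u hv
    have h2 := h.admissible.a_le u (mem_sdiff.1 hv).1
    have h3 := h.admissible.b_le u (mem_sdiff.1 hv).1
    unfold weight
    simp only [hfs, and_self, if_true] at h1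
    have hbu := hbpos u
    simp only [hfs, and_self, if_true] at hbu
    rcases hapos u with h4 | h4 <;> rcases hbu with h5 | h5 <;> omega
  obtain ⟨A, hA, hAne, hpot⟩ := exists_of_not_admissible
    (fun v hv => (ha'le v).trans (h.admissible.a_le v (mem_sdiff.1 hv).1))
    (fun v hv => (hb'le v).trans (h.admissible.b_le v (mem_sdiff.1 hv).1)) hnot
  refine ⟨A, hA, hAne, ?_⟩
  have hunion : potential G a b (S ∪ A) = potential G a b S + potential G a' b' A
      + ∑ v ∈ A, (weight (a v) (b v) - weight (a' v) (b' v) - 9 * degIn G S v) := by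
    rw [potential_union (disjoint_sdiff.mono_right hA), potential_eq_add_sum (a' := a') (b' := b') A]
    simp only [sum_sub_distrib, mul_sum]
    ring
  have hsum0 := sum_nonpos fun v hv => hslack v (hA hv)
  have hsum1 : u ∈ A → _ := fun hu =>
    sum_le_of_nonpos_of_mem (fun v hv => hslack v (hA hv)) hu (hslack1 (hA hu))
  rcases hpot with hpot | ⟨c, hc⟩
  · by_cases hu : u ∈ A
    · have := hsum1 hu
      left
      linarith
    · exact Or.inr ⟨by linarith, fun hu' => absurd hu' hu⟩
  · have ha2 : ∀ v ∈ A, a' v ≤ 2 := fun v hv =>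
      (ha'le v).trans (h.admissible.a_le v (mem_sdiff.1 (hA hv)).1)
    have h3 := hc.potential_le_neg_three ha2
    by_cases hu : u ∈ A
    · have h4 := hsum1 hu
      cases hfs : f s
      · have := sum_le_of_nonpos_of_mem (fun v hv => hslack v (hA hv)) hu
          (hslack9 (hA hu) hfs (hc.b_eq_zero u hu))
        left
        linarith
      · obtain ⟨hs, hadj, -⟩ := hsu (hA hu)
        have ha0 : a' u = 0 := if_pos ⟨s, hs, hadj.symm, hfs⟩
        by_cases huc : u = c
        · refine Or.inr ⟨by linarith, fun _ => ⟨by linarith, ?_⟩⟩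
          rw [hc.card_eq, ← huc, ha0]
        · have h5 : ∑ v ∈ A.erase c, 4 * ((a' v : ℤ) - 2) ≤ -8 :=
            sum_le_of_nonpos_of_mem (fun v hv => by
              have := ha2 v (mem_of_mem_erase hv)
              omega) (mem_erase.2 ⟨huc, hu⟩) (by rw [ha0]; norm_num)
          have h6 := hc.potential_le
          left
          linarith
    · exact Or.inr ⟨by linarith, fun huA => absurd huA hu⟩

/-! ### Potentials of proper subsets -/

lemma IsColoring.mono {f : V → Bool} (h : IsColoring G a' b' S f) (ha : ∀ v ∈ S, a' v ≤ a v)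
    (hb : ∀ v ∈ S, b' v ≤ b v) : IsColoring G a b S f := fun v hv => by
  refine (h v hv).trans_le ?_
  cases f v
  exacts [hb v hv, ha v hv]

lemma update_sub_one_le (b : V → ℕ) (s v : V) : Function.update b s (b s - 1) v ≤ b v := by
  rcases eq_or_ne v s with rfl | hv
  · simp
  · simp [hv]

lemma weight_sub_weight_update (a b : V → ℕ) (s v : V) :
    weight (a v) (b v) - weight (a v) (Function.update b s (b s - 1) v)
      ≤ if v = s then 3 else 0 := by
  rcases eq_or_ne v s with rfl | hv
  · simp only [Function.update_self, if_true, weight]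
    omega
  · simp [hv]

lemma Admissible.update_sub_one (h : Admissible G a b S)
    (hS : ∀ B ⊆ S, B.Nonempty → -2 ≤ potential G a b B) (s : V) :
    Admissible G a (Function.update b s (b s - 1)) S := by
  by_contra hnot
  obtain ⟨A, hA, hAne, hpot⟩ := exists_of_not_admissible h.a_le
    (fun v hv => (update_sub_one_le b s v).trans (h.b_le v hv)) hnot
  have h1 := hS A hA hAne
  have h2 := potential_eq_add_sum (G := G) (a := a) (b := b) (a' := a)
    (b' := Function.update b s (b s - 1)) A
  rcases hpot with hpot | ⟨c, hc⟩
  · have h3 := sum_le_sum fun v (_ : v ∈ A) => weight_sub_weight_update a b s v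
    rw [sum_ite_eq'] at h3
    split_ifs at h3 <;> linarith
  · have h3 := hc.potential_le_neg_three fun v hv => h.a_le v (hA hv)
    have h4 : ∑ v ∈ A, (weight (a v) (b v) - weight (a v) (Function.update b s (b s - 1) v)) = 0 :=
      sum_eq_zero fun v hv => by
        have h5 := hc.b_eq_zero v hv
        rcases eq_or_ne v s with rfl | hvs
        · rw [Function.update_self] at h5 ⊢
          simp only [weight]
          omega
        · simp [hvs]
    linarith

lemma IsMinimal.exists_adj (h : IsMinimal G a b U) (hS : S ⊂ U) (hne : S.Nonempty) :
    ∃ s ∈ S, ∃ u ∈ U \ S, G.Adj s u := by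
  by_contra! hadj
  have hlt : U \ S ⊂ U := by
    refine ⟨sdiff_subset, fun hU => ?_⟩
    obtain ⟨x, hx⟩ := hne
    exact (mem_sdiff.1 (hU (hS.1 hx))).2 hx
  obtain ⟨f, hf⟩ := h.exists_isColoring_of_ssubset hS (fun _ _ => le_rfl) (h.admissible.mono hS.1)
  obtain ⟨g, hg⟩ := h.exists_isColoring_of_ssubset hlt (fun _ _ => le_rfl)
    (h.admissible.mono hlt.1)
  refine h.not_glue hS.1 f g (fun v hv => ?_) fun v hv => ?_
  · rw [filter_false_of_mem (s := U \ S) fun u hu hvu => hadj v hv u hu hvu.1]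
    exact hf v hv
  · rw [filter_false_of_mem (s := S) fun u hu hvu => hadj u hu v hv hvu.1.symm]
    simpa using hg v hv

lemma IsMinimal.exists_potential_union_le_of_adj (h : IsMinimal G a b U) (hS : S ⊂ U)
    (hpot : ∀ B ⊆ S, B.Nonempty → -2 ≤ potential G a b B) {s u : V} (hs : s ∈ S)
    (hadj : G.Adj s u) :
    ∃ A ⊆ U \ S, A.Nonempty ∧ (potential G a b (S ∪ A) ≤ potential G a b S - 7 ∨
      potential G a b (S ∪ A) ≤ potential G a b S - 3 ∧
        (u ∈ A → potential G a b (S ∪ A) ≤ potential G a b S - 4 ∧ #A = 1)) := by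
  obtain ⟨f, hf⟩ := h.exists_isColoring_of_ssubset hS (fun v _ => update_sub_one_le b s v)
    ((h.admissible.mono hS.1).update_sub_one hpot s)
  refine h.exists_potential_union_le hS ⟨s, hs⟩
    (hf.mono (fun _ _ => le_rfl) fun v _ => update_sub_one_le b s v) fun _ => ⟨hs, hadj, fun hfs => ?_⟩
  have := hf s hs
  simp only [hfs, cond_false, Function.update_self] at this
  omega

lemma IsMinimal.neg_two_le_potential (h : IsMinimal G a b U) (hS : S ⊂ U) (hne : S.Nonempty) :
    -2 ≤ potential G a b S := by
  obtain ⟨T, hT, hmin⟩ := exists_min_image {T ∈ U.ssubsets | T.Nonempty} (potential G a b)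
    ⟨S, by simp [hS, hne]⟩
  simp only [mem_filter, mem_ssubsets] at hT hmin
  refine le_trans ?_ (hmin S ⟨hS, hne⟩)
  by_contra! hlt
  obtain ⟨f, hf⟩ := h.exists_isColoring_of_ssubset hT.1 (fun _ _ => le_rfl)
    (h.admissible.mono hT.1.1)
  obtain ⟨t, ht⟩ := hT.2
  obtain ⟨A, hA, hAne, hpot⟩ := h.exists_potential_union_le hT.1 hT.2 hf (s := t) (u := t)
    fun hu => absurd ht (mem_sdiff.1 hu).2
  have hle : potential G a b (T ∪ A) ≤ potential G a b T - 3 := by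
    rcases hpot with hpot | hpot
    · linarith
    · exact hpot.1
  have hsub : T ∪ A ⊆ U := union_subset hT.1.1 (hA.trans sdiff_subset)
  rcases hsub.eq_or_ssubset with heq | hss
  · have := h.admissible.le_potential _ hsub ⟨t, mem_union_left _ ht⟩
    linarith
  · have := hmin _ ⟨hss, t, mem_union_left _ ht⟩
    linarith

lemma IsMinimal.neg_one_le_potential (h : IsMinimal G a b U) (hS : S ⊂ U) (hne : S.Nonempty) :
    -1 ≤ potential G a b S := by
  by_contra! hlt
  have h2 := h.neg_two_le_potential hS hne
  obtain ⟨s, hs, u, hu, hadj⟩ := h.exists_adj hS hne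
  obtain ⟨A, hA, hAne, hpot⟩ := h.exists_potential_union_le_of_adj hS
    (fun B hB => h.neg_two_le_potential (hB.trans_ssubset hS)) hs hadj
  have hsub : S ∪ A ⊆ U := union_subset hS.1 (hA.trans sdiff_subset)
  have hne' : (S ∪ A).Nonempty := ⟨s, mem_union_left _ hs⟩
  have h3 := h.admissible.le_potential _ hsub hne'
  rcases hsub.eq_or_ssubset with heq | hss
  · have huA : u ∈ A := by
      have := mem_sdiff.1 hu
      rw [← heq, mem_union] at this
      tauto
    rcases hpot with hpot | hpot
    · linarith
    · have := (hpot.2 huA).1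
      linarith
  · have := h.neg_two_le_potential hss hne'
    rcases hpot with hpot | hpot <;> linarith

lemma IsMinimal.two_le_potential (h : IsMinimal G a b U) (hS : S ⊆ U) (hcard : #S + 2 ≤ #U)
    (hne : S.Nonempty) : 2 ≤ potential G a b S := by
  by_contra! hlt
  have hSU : S ⊂ U := by
    refine hS.ssubset_of_ne ?_
    rintro rfl
    omega
  obtain ⟨s, hs, u, hu, hadj⟩ := h.exists_adj hSU hne
  obtain ⟨A, hA, hAne, hpot⟩ := h.exists_potential_union_le_of_adj hSU
    (fun B hB => h.neg_two_le_potential (hB.trans_ssubset hSU)) hs hadj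
  have hsub : S ∪ A ⊆ U := union_subset hS (hA.trans sdiff_subset)
  have hne' : (S ∪ A).Nonempty := ⟨s, mem_union_left _ hs⟩
  have h3 := h.admissible.le_potential _ hsub hne'
  rcases hsub.eq_or_ssubset with heq | hss
  · have huA : u ∈ A := by
      have := mem_sdiff.1 hu
      rw [← heq, mem_union] at this
      tauto
    rcases hpot with hpot | hpot
    · linarith
    · have h4 := (hpot.2 huA).2
      have h5 := card_union_le S A
      rw [heq] at h5
      omega
  · have := h.neg_one_le_potential hss hne'
    rcases hpot with hpot | hpot <;> linarith

/-! ### Tolerances of the vertices -/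

lemma IsMinimal.exists_adj_vertex (h : IsMinimal G a b U) {v : V} (hv : v ∈ U) (hbv : b v ≠ 0) :
    ∃ y ∈ U, G.Adj v y := by
  rcases (singleton_subset_iff.2 hv).eq_or_ssubset with heq | hss
  · refine absurd ?_ (h.not_isColoring fun _ => false)
    intro w hw
    rw [← heq, mem_singleton] at hw
    subst hw
    rw [← heq]
    simpa [filter_singleton] using Nat.pos_of_ne_zero hbv
  · obtain ⟨s, hs, u, hu, hadj⟩ := h.exists_adj hss (singleton_nonempty v)
    rw [mem_singleton] at hs
    exact ⟨u, (mem_sdiff.1 hu).1, hs ▸ hadj⟩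

lemma isColoring_of_deleteEdges {f : V → Bool} {v y : V}
    (hf : IsColoring (G.deleteEdges {s(v, y)}) a' b' S f) (ha : ∀ w ∈ S, a' w ≤ a w)
    (hb : ∀ w ∈ S, b' w ≤ b w)
    (hvy : f v = f y → ∀ w, w = v ∨ w = y →
      (bif f w then a' w else b' w) ≤ (bif f w then a w else b w) - 1) :
    IsColoring G a b S f := by
  obtain ⟨G', hG', hadj⟩ : ∃ G', G' = G.deleteEdges {s(v, y)} ∧
      ∀ w u, G'.Adj w u ↔ G.Adj w u ∧ ¬(w = v ∧ u = y ∨ w = y ∧ u = v) :=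
    ⟨_, rfl, fun w u => by simp [SimpleGraph.deleteEdges_adj]⟩
  rw [← hG'] at hf
  intro w hw
  have h1 := hf w hw
  have h2 := hf.mono ha hb w hw
  by_cases hc : f v = f y ∧ (w = v ∨ w = y)
  · have h3 := hvy hc.1 w hc.2
    obtain ⟨z, hz⟩ : ∃ z, ∀ u, G.Adj w u → u ≠ z → G'.Adj w u := by
      simp only [hadj]
      rcases hc.2 with rfl | rfl
      · exact ⟨y, fun u hu hne => ⟨hu, by have := hu.ne; aesop⟩⟩
      · exact ⟨v, fun u hu hne => ⟨hu, by have := hu.ne; aesop⟩⟩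
    have h4 : #{u ∈ S | G.Adj w u ∧ f u = f w}
        ≤ #(insert z {u ∈ S | G'.Adj w u ∧ f u = f w}) := by
      refine card_le_card fun u hu => ?_
      simp only [mem_filter, mem_insert] at hu ⊢
      by_cases hne : u = z
      · exact Or.inl hne
      · exact Or.inr ⟨hu.1, hz u hu.2.1 hne, hu.2.2⟩
    have h5 := h4.trans (card_insert_le _ _)
    omega
  · refine lt_of_eq_of_lt ?_ h2
    refine congrArg card (filter_congr fun u hu => ?_)
    simp only [hadj]
    constructor
    · rintro ⟨hwu, hfu⟩
      refine ⟨⟨hwu, ?_⟩, hfu⟩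
      rintro (⟨rfl, rfl⟩ | ⟨rfl, rfl⟩)
      · exact hc ⟨hfu.symm, Or.inl rfl⟩
      · exact hc ⟨hfu, Or.inr rfl⟩
    · exact fun hwu => ⟨hwu.1.1, hwu.2⟩

lemma potential_deleteEdges {v y : V} (hvy : G.Adj v y) (A : Finset V) :
    potential G a b A = potential (G.deleteEdges {s(v, y)}) a b A
      - if v ∈ A ∧ y ∈ A then 9 else 0 := by
  unfold potential
  rw [edgesIn_deleteEdges hvy]
  split_ifs <;> push_cast <;> ring

lemma IsMinimal.exists_isColoring_deleteEdges (h : IsMinimal G a b U) {v y : V} (hv : v ∈ U)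
    (hy : y ∈ U) (hvy : G.Adj v y) (ha : ∀ w, a' w ≤ a w) (hb : ∀ w, b' w ≤ b w)
    (hw : ∀ w ∈ U, weight (a w) (b w) - weight (a' w) (b' w)
      ≤ (if w = v then 4 else 0) + if w = y then 4 else 0) :
    (∃ f, IsColoring (G.deleteEdges {s(v, y)}) a' b' U f) ∨
      ∃ A ⊆ U, ∃ c, IsObstruction (G.deleteEdges {s(v, y)}) a' b' A c := by
  by_cases hadm : Admissible (G.deleteEdges {s(v, y)}) a' b' U
  · refine Or.inl (h.exists_isColoring _ a' b' U ?_ hadm)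
    have h1 := edgesIn_deleteEdges hvy U
    rw [if_pos ⟨hv, hy⟩] at h1
    have h2 := sum_le_sum fun w (_ : w ∈ U) => hb w
    unfold size
    omega
  · obtain ⟨A, hA, hAne, hpot | hobs⟩ := exists_of_not_admissible
      (fun w hw => (ha w).trans (h.admissible.a_le w hw))
      (fun w hw => (hb w).trans (h.admissible.b_le w hw)) hadm
    · have h1 := potential_deleteEdges (a := a) (b := b) hvy A
      have h2 := potential_eq_add_sum (G := G.deleteEdges {s(v, y)}) (a := a) (b := b) (a' := a')
        (b' := b') A
      have h3 := sum_le_sum fun w hwA => hw w (hA hwA)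
      rw [sum_add_distrib, sum_ite_eq', sum_ite_eq'] at h3
      have h4 := h.admissible.le_potential A hA hAne
      rcases hA.eq_or_ssubset with rfl | hss
      · simp only [hv, hy, and_self, if_true] at h1 h3
        linarith
      · have h5 := h.neg_one_le_potential hss hAne
        split_ifs at h1 h3 <;> first | linarith | tauto
    · exact Or.inr ⟨A, hA, hobs⟩

lemma IsMinimal.a_ne_zero (h : IsMinimal G a b U) {v : V} (hv : v ∈ U) : a v ≠ 0 := by
  intro hav
  have hbv : b v ≠ 0 := fun hbv => by simpa [hav] using h.admissible.forced v hv hbv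
  obtain ⟨y, hy, hvy⟩ := h.exists_adj_vertex hv hbv
  set b' : V → ℕ := fun w => if w = v ∨ w = y then b w - 1 else b w with hb'
  have hb'le : ∀ w, b' w ≤ b w := fun w => by simp only [hb']; split_ifs <;> omega
  rcases h.exists_isColoring_deleteEdges hv hy hvy (fun _ => le_rfl) hb'le (fun w _ => by
    by_cases h1 : w = v <;> by_cases h2 : w = y <;> simp only [hb', h1, h2, weight, true_or, or_true,
      or_self, if_true, if_false] <;> omega) with ⟨f, hf⟩ | ⟨A, hA, c, hc⟩
  · have hfv : f v = false := by
      by_contra hfv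
      have := hf v hv
      simp [Bool.eq_true_of_not_eq_false hfv, hav] at this
    refine h.not_isColoring f (isColoring_of_deleteEdges hf (fun _ _ => le_rfl)
      (fun w _ => hb'le w) fun hfvy w hw => ?_)
    have hfw : f w = false := by rcases hw with rfl | rfl <;> simp [← hfvy, hfv]
    simp only [hfw, hb', if_pos hw, cond_false, le_refl]
  · have h1 := potential_deleteEdges (a := a) (b := b) hvy A
    have h2 := potential_eq_add_sum (G := G.deleteEdges {s(v, y)}) (a := a) (b := b) (a' := a)
      (b' := b') A
    have h3 : ∑ w ∈ A, (weight (a w) (b w) - weight (a w) (b' w)) = 0 := sum_eq_zero fun w hw => by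
      have h4 := hc.b_eq_zero w hw
      have h5 : b w ≤ 1 := by simp only [hb'] at h4; split_ifs at h4 <;> omega
      simp only [weight, h4]
      omega
    have h4 := h.admissible.le_potential A hA ⟨c, hc.mem⟩
    have h5 := hc.potential_le_neg_three fun w hw => h.admissible.a_le w (hA hw)
    rcases hA.eq_or_ssubset with rfl | hss
    · simp only [hv, hy, and_self, if_true] at h1
      linarith
    · have h6 := h.neg_one_le_potential hss ⟨c, hc.mem⟩
      split_ifs at h1 <;> linarith

lemma IsMinimal.exists_le_card (h : IsMinimal G a b U) {v : V} (hv : v ∈ U) (hbv : b v ≠ 0) :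
    ∃ w ∈ U, w ≠ v ∧ a w ≤ #{u ∈ U | G.Adj w u ∧ u ≠ v} := by
  by_contra! hlt
  refine h.not_isColoring (fun w => decide (w ≠ v)) fun w hw => ?_
  rcases eq_or_ne w v with rfl | hwv
  · rw [filter_false_of_mem fun u hu hwu => ?_]
    · simpa using Nat.pos_of_ne_zero hbv
    · have := hwu.1.ne'
      simp_all
  · simpa [hwv] using hlt w hw hwv

lemma IsMinimal.exists_b_ne_zero (h : IsMinimal G a b U) : ∃ v ∈ U, b v ≠ 0 := by
  by_contra! hb
  refine h.not_isColoring (fun _ => true) fun w hw => ?_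
  have := h.admissible.forced w hw (hb w hw)
  rw [filter_congr fun u hu => and_congr_right fun _ => iff_of_true (hb u hu) trivial] at this
  simpa using this

lemma IsMinimal.exists_ne_b_ne_zero (h : IsMinimal G a b U) {v : V} (hv : v ∈ U)
    (hbv : b v ≠ 0) : ∃ w ∈ U, w ≠ v ∧ b w ≠ 0 := by
  by_contra! hb
  obtain ⟨w, hw, hwv, hle⟩ := h.exists_le_card hv hbv
  have h1 := h.admissible.forced w hw (hb w hw hwv)
  refine absurd (hle.trans (card_le_card fun u hu => ?_)) (not_le.2 h1)
  simp only [mem_filter] at hu ⊢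
  exact ⟨hu.1, hu.2.1, hb u hu.1 hu.2.2⟩

lemma IsMinimal.b_ne_one (h : IsMinimal G a b U) {v : V} (hv : v ∈ U) : b v ≠ 1 := by
  intro hbv
  have hle := update_sub_one_le b v
  have hnot : ¬ Admissible G a (Function.update b v (b v - 1)) U := fun hadm => by
    obtain ⟨f, hf⟩ := h.exists_isColoring G a _ U (by
      have : ∑ w ∈ U, Function.update b v (b v - 1) w < ∑ w ∈ U, b w :=
        sum_lt_sum (fun w _ => hle w) ⟨v, hv, by simp [hbv]⟩
      unfold size
      omega) hadm
    exact h.not_isColoring f (hf.mono (fun _ _ => le_rfl) fun w _ => hle w)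
  obtain ⟨A, hA, hAne, hpot⟩ := exists_of_not_admissible h.admissible.a_le
    (fun w hw => (hle w).trans (h.admissible.b_le w hw)) hnot
  have h1 := potential_eq_add_sum (G := G) (a := a) (b := b) (a' := a)
    (b' := Function.update b v (b v - 1)) A
  have h2 : ∑ w ∈ A, (weight (a w) (b w) - weight (a w) (Function.update b v (b v - 1) w)) = 0 :=
    sum_eq_zero fun w _ => by
      rcases eq_or_ne w v with rfl | hw
      · simp [hbv, weight]
      · simp [hw]
  have h3 := h.admissible.le_potential A hA hAne
  rcases hpot with hpot | ⟨c, hc⟩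
  · linarith
  · have h4 := hc.potential_le_neg_three fun w hw => h.admissible.a_le w (hA hw)
    rcases hA.eq_or_ssubset with rfl | hss
    · obtain ⟨w, hw, hwv, hbw⟩ := h.exists_ne_b_ne_zero hv (by omega)
      have := hc.b_eq_zero w hw
      rw [Function.update_of_ne hwv] at this
      exact hbw this
    · have := h.neg_one_le_potential hss hAne
      linarith

lemma IsMinimal.two_lt_card (h : IsMinimal G a b U) : 2 < #U := by
  by_contra! hU
  obtain ⟨v, hv, hbv⟩ := h.exists_b_ne_zero
  obtain ⟨w, hw, hwv, hle⟩ := h.exists_le_card hv hbv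
  have h1 := h.a_ne_zero hw
  obtain ⟨u, hu⟩ := card_pos.1 (show 0 < #{u ∈ U | G.Adj w u ∧ u ≠ v} by omega)
  simp only [mem_filter] at hu
  have h2 : #{v, w, u} ≤ #U := card_le_card (by simp [insert_subset_iff, hv, hw, hu.1])
  rw [card_eq_three.2 ⟨v, w, u, hwv.symm, hu.2.2.symm, hu.2.1.ne, rfl⟩] at h2
  omega

lemma IsMinimal.two_le_weight (h : IsMinimal G a b U) {v : V} (hv : v ∈ U) :
    2 ≤ weight (a v) (b v) := by
  rw [← potential_singleton (G := G) (a := a) (b := b)]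
  refine h.two_le_potential (singleton_subset_iff.2 hv) ?_ (singleton_nonempty v)
  have := h.two_lt_card
  simp
  omega

lemma IsMinimal.b_ne_zero (h : IsMinimal G a b U) {v : V} (hv : v ∈ U) : b v ≠ 0 := by
  intro hbv
  have hav : a v = 2 := by
    have h1 := h.two_le_weight hv
    have h2 := h.admissible.a_le v hv
    rw [hbv] at h1
    simp only [weight] at h1
    omega
  obtain ⟨y, hy, hvy, hyb⟩ : ∃ y ∈ U, G.Adj v y ∧ (b y ≠ 0 → ∀ w ∈ U, G.Adj v w → b w ≠ 0) := by
    by_cases hex : ∃ y ∈ U, G.Adj v y ∧ b y = 0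
    · obtain ⟨y, hy, hvy, hby⟩ := hex
      exact ⟨y, hy, hvy, fun hby' => absurd hby hby'⟩
    · push Not at hex
      have hss : {v} ⊂ U := by
        refine (singleton_subset_iff.2 hv).ssubset_of_ne ?_
        rintro heq
        have := h.two_lt_card
        simp [← heq] at this
      obtain ⟨s, hs, u, hu, hadj⟩ := h.exists_adj hss (singleton_nonempty v)
      rw [mem_singleton] at hs
      exact ⟨u, (mem_sdiff.1 hu).1, hs ▸ hadj, fun _ => hex⟩
  set a' : V → ℕ := fun w => if w = v ∨ w = y then a w - 1 else a w with ha'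
  have ha'le : ∀ w, a' w ≤ a w := fun w => by simp only [ha']; split_ifs <;> omega
  rcases h.exists_isColoring_deleteEdges hv hy hvy ha'le (fun _ => le_rfl) (fun w _ => by
    by_cases h1 : w = v <;> by_cases h2 : w = y <;>
      simp only [ha', h1, h2, weight, true_or, or_true, or_self, if_true, if_false] <;> omega)
    with ⟨f, hf⟩ | ⟨A, hA, c, hc⟩
  · have hfv : f v = true := by
      by_contra hfv
      have := hf v hv
      simp [Bool.eq_false_of_not_eq_true hfv, hbv] at this
    refine h.not_isColoring f (isColoring_of_deleteEdges hf (fun w _ => ha'le w)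
      (fun _ _ => le_rfl) fun hfvy w hw => ?_)
    have hfw : f w = true := by rcases hw with rfl | rfl <;> simp [← hfvy, hfv]
    simp only [hfw, ha', if_pos hw, cond_true, le_refl]
  · have hbc := hc.b_eq_zero c hc.mem
    have hcU := hA hc.mem
    have h1 := h.admissible.forced c hcU hbc
    have hsub : A.erase c ⊆ {u ∈ U | G.Adj c u ∧ b u = 0} := fun u hu => by
      have h2 := hc.adj u (mem_of_mem_erase hu) (ne_of_mem_erase hu)
      rw [SimpleGraph.deleteEdges_adj] at h2
      simp [hA (mem_of_mem_erase hu), h2.1, hc.b_eq_zero u (mem_of_mem_erase hu)]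
    have hcard : #(A.erase c) = a' c := by
      rw [card_erase_of_mem hc.mem, hc.card_eq, Nat.add_sub_cancel]
    have hcvy : c = v ∨ c = y := by
      by_contra hne
      have h2 := card_le_card hsub
      simp only [hcard, ha', if_neg hne] at h2
      omega
    by_cases hby : b y = 0
    · obtain ⟨z, hz, hzn⟩ : ∃ z ∈ ({u ∈ U | G.Adj c u ∧ b u = 0} : Finset V), z ∉ A.erase c := by
        rcases hcvy with rfl | rfl
        · refine ⟨y, by simp [hy, hvy, hby], fun hyA => ?_⟩
          simpa [SimpleGraph.deleteEdges_adj] using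
            hc.adj y (mem_of_mem_erase hyA) (ne_of_mem_erase hyA)
        · refine ⟨v, by simp [hv, hvy.symm, hbv], fun hyA => ?_⟩
          simpa [SimpleGraph.deleteEdges_adj, Sym2.eq_swap] using
            hc.adj v (mem_of_mem_erase hyA) (ne_of_mem_erase hyA)
      have h2 := card_lt_card ((ssubset_iff_of_subset hsub).2 ⟨z, hz, hzn⟩)
      simp only [hcard, ha', if_pos hcvy] at h2
      omega
    · have hcv : c = v := hcvy.resolve_right fun hcy => hby (hcy ▸ hbc)
      subst hcv
      have h2 : #(A.erase c) = 0 := by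
        rw [card_eq_zero, eq_empty_iff_forall_notMem]
        intro u hu
        have := mem_filter.1 (hsub hu)
        exact hyb hby u this.1 this.2.1 this.2.2
      simp only [hcard, ha', true_or, if_true, hav] at h2
      omega

lemma IsMinimal.two_le_b (h : IsMinimal G a b U) {v : V} (hv : v ∈ U) : 2 ≤ b v := by
  have h1 := h.b_ne_zero hv
  have h2 := h.b_ne_one hv
  omega

/-! ### Reducible configurations -/

/-- The vertices of degree two with the largest possible tolerances. -/
noncomputable def light (G : SimpleGraph V) (a b : V → ℕ) (U : Finset V) : Finset V :=
  {v ∈ U | a v = 2 ∧ b v = 4 ∧ degIn G U v = 2}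

lemma IsMinimal.admissible_of_b_ne_zero (h : IsMinimal G a b U) (hS : S ⊆ U)
    (ha : ∀ v, a' v ≤ a v) (hb : ∀ v, b' v ≤ b v) (hb0 : ∀ v ∈ S, b' v ≠ 0)
    (hpot : ∀ A ⊆ S, A.Nonempty → -5 + ∑ v ∈ A, (weight (a v) (b v) - weight (a' v) (b' v))
      ≤ potential G a b A) : Admissible G a' b' S where
  a_le v hv := (ha v).trans (h.admissible.a_le v (hS hv))
  b_le v hv := (hb v).trans (h.admissible.b_le v (hS hv))
  le_potential A hA hne := by
    have h1 := hpot A hA hne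
    rw [potential_eq_add_sum (a' := a') (b' := b')] at h1
    linarith
  forced v hv hbv := absurd hbv (hb0 v hv)

lemma IsMinimal.b_lt_degIn (h : IsMinimal G a b U) {s : V} (hs : s ∈ U) (hsD : s ∉ light G a b U) :
    b s < degIn G U s := by
  by_contra! hdeg
  set b' : V → ℕ := fun v => if G.Adj s v then b v - 1 else b v with hb'
  have hb'le : ∀ v, b' v ≤ b v := fun v => by simp only [hb']; split_ifs <;> omega
  have hss : U.erase s ⊂ U := erase_ssubset hs
  have has := h.admissible.a_le s hs
  have hbs := h.admissible.b_le s hs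
  have hbs' := h.two_le_b hs
  have hadm : Admissible G a b' (U.erase s) := by
    refine h.admissible_of_b_ne_zero hss.1 (fun _ => le_rfl) hb'le (fun v hv => ?_)
      fun A hA hne => ?_
    · have := h.two_le_b (mem_of_mem_erase hv)
      simp only [hb']
      split_ifs <;> omega
    · have hsum : ∑ v ∈ A, (weight (a v) (b v) - weight (a v) (b' v)) = 3 * degIn G A s := by
        unfold degIn
        rw [card_filter, Nat.cast_sum, mul_sum]
        refine sum_congr rfl fun v hv => ?_
        have := h.two_le_b (hss.1 (hA hv))
        simp only [hb', weight]
        split_ifs <;> push_cast <;> omega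
      have hsA : s ∉ A := fun hsA => by simpa using hA hsA
      have h1 := potential_insert (G := G) (a := a) (b := b) hsA
      have h2 := h.admissible.le_potential (insert s A) (insert_subset hs (hA.trans hss.1))
        (insert_nonempty _ _)
      have h3 := h.neg_one_le_potential (hA.trans_ssubset hss) hne
      have h4 : degIn G A s ≤ degIn G U s := degIn_mono (hA.trans hss.1) s
      rw [hsum]
      by_cases hj : degIn G A s = 2
      · by_cases hd : degIn G U s = 2
        · have h5 : ¬ (a s = 2 ∧ b s = 4) := fun h5 =>
            hsD (mem_filter.2 ⟨hs, h5.1, h5.2, hd⟩)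
          simp only [weight] at h1
          omega
        · obtain ⟨u, hu, huA⟩ : ∃ u ∈ ({u ∈ U | G.Adj s u} : Finset V),
              u ∉ ({u ∈ A | G.Adj s u} : Finset V) := by
            refine exists_mem_notMem_of_card_lt_card ?_
            change degIn G A s < degIn G U s
            omega
          simp only [mem_filter, not_and] at hu huA
          have hus : u ≠ s := hu.2.ne'
          have huA' : u ∉ insert s A := by
            simp only [mem_insert, not_or]
            exact ⟨hus, fun huA' => huA huA' hu.2⟩
          have h5 : #(insert u (insert s A)) ≤ #U := card_le_card (by
            simp [insert_subset_iff, hu.1, hs, hA.trans hss.1])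
          rw [card_insert_of_notMem huA', card_insert_of_notMem hsA] at h5
          have h6 := h.two_le_potential (hA.trans hss.1) (by omega) hne
          rw [hj]
          norm_num
          linarith
      · simp only [weight] at h1
        omega
  obtain ⟨f, hf⟩ := h.exists_isColoring_of_ssubset hss (fun v _ => hb'le v) hadm
  have hsplit : degIn G (U.erase s) s = degIn G U s := by
    conv_rhs => rw [← insert_erase hs]
    rw [degIn_insert (by simp)]
    simp
  have hle : #{u ∈ U.erase s | G.Adj s u ∧ f u = false} ≤ degIn G (U.erase s) s :=
    card_le_card fun u hu => by simp_all
  refine h.not_glue hss.1 f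
    (fun _ => decide (¬ #{u ∈ U.erase s | G.Adj s u ∧ f u = false} < b s))
    (fun v hv => ?_) fun v hv => ?_
  · have h1 := hf v hv
    rw [sdiff_erase_self hs]
    have h2 : #{u ∈ {s} | G.Adj v u ∧
        decide (¬ #{u ∈ U.erase s | G.Adj s u ∧ f u = false} < b s) = f v} ≤ 1 :=
      (card_filter_le _ _).trans (card_singleton s).le
    by_cases hvs : G.Adj v s
    · cases hfv : f v
      · simp only [hfv, cond_false, hb', if_pos hvs.symm] at h1 h2 ⊢
        omega
      · simp only [hfv, cond_true] at h1 ⊢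
        rw [filter_false_of_mem (s := {s}) fun u _ hu => ?_]
        · simpa using h1
        · have hall : {u ∈ U.erase s | G.Adj s u ∧ f u = false}
              = ({u ∈ U.erase s | G.Adj s u} : Finset V) := by
            refine eq_of_subset_of_card_le (fun u hu => by simp_all) ?_
            change degIn G (U.erase s) s ≤ _
            have := of_decide_eq_true hu.2
            omega
          have hmem : v ∈ ({u ∈ U.erase s | G.Adj s u} : Finset V) :=
            mem_filter.2 ⟨hv, hvs.symm⟩
          rw [← hall, mem_filter, hfv] at hmem
          simp at hmem
    · rw [filter_false_of_mem (s := {s}) fun u hu hvu =>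
        hvs (mem_singleton.1 hu ▸ hvu.1)]
      refine h1.trans_le ?_
      cases f v
      exacts [hb'le v, le_rfl]
  · rw [sdiff_erase_self hs] at hv ⊢
    obtain rfl := mem_singleton.1 hv
    rw [filter_false_of_mem (s := {v}) fun u hu hvu => hvu.1.ne (mem_singleton.1 hu).symm,
      card_empty, add_zero]
    by_cases hlt : #{u ∈ U.erase v | G.Adj v u ∧ f u = false} < b v
    · simp [hlt]
    · have hall : {u ∈ U.erase v | G.Adj v u ∧ f u = false}
          = ({u ∈ U.erase v | G.Adj v u} : Finset V) := by
        refine eq_of_subset_of_card_le (fun u hu => by simp_all) ?_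
        change degIn G (U.erase v) v ≤ _
        omega
      rw [filter_false_of_mem fun u hu hvu => ?_]
      · simpa [hlt] using Nat.pos_of_ne_zero (h.a_ne_zero hs)
      · have hmem : u ∈ ({u ∈ U.erase v | G.Adj v u} : Finset V) := mem_filter.2 ⟨hu, hvu.1⟩
        rw [← hall, mem_filter] at hmem
        simp [hlt, hmem.2.2] at hvu

lemma exists_of_mem_light {x y : V} (hx : x ∈ light G a b U) (hy : y ∈ U) (hxy : G.Adj x y) :
    ∃ t ∈ U, t ≠ y ∧ G.Adj x t ∧ ∀ u ∈ U, G.Adj x u → u = y ∨ u = t := by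
  obtain ⟨p, q, hpq, hset⟩ := card_eq_two.1 (mem_filter.1 hx).2.2.2
  have hmem : ∀ u, u ∈ U ∧ G.Adj x u ↔ u = p ∨ u = q := fun u => by
    rw [← mem_filter, hset, mem_insert, mem_singleton]
  rcases (hmem y).1 ⟨hy, hxy⟩ with rfl | rfl
  · have := (hmem q).2 (Or.inr rfl)
    exact ⟨q, this.1, hpq.symm, this.2, fun u hu hxu => (hmem u).1 ⟨hu, hxu⟩⟩
  · have := (hmem p).2 (Or.inl rfl)
    exact ⟨p, this.1, hpq, this.2, fun u hu hxu => ((hmem u).1 ⟨hu, hxu⟩).symm⟩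

lemma lt_cond_of_mem_light {x : V} (hx : x ∈ light G a b U) {n : ℕ} (hn : n ≤ 1) (c : Bool) :
    n < bif c then a x else b x := by
  have := (mem_filter.1 hx).2
  cases c <;> simp only [cond_true, cond_false] <;> omega

lemma IsMinimal.not_adj_of_mem_light (h : IsMinimal G a b U) {x y : V} (hx : x ∈ light G a b U)
    (hy : y ∈ light G a b U) : ¬ G.Adj x y := by
  intro hxy
  have hxU := (mem_filter.1 hx).1
  have hyU := (mem_filter.1 hy).1
  obtain ⟨p, hp, hpy, hxp, hxn⟩ := exists_of_mem_light hx hyU hxy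
  obtain ⟨q, hq, hqx, hyq, hyn⟩ := exists_of_mem_light hy hxU hxy.symm
  have hR : {x, y} ⊆ U := by simp [insert_subset_iff, hxU, hyU]
  have hS : U \ {x, y} ⊂ U := sdiff_ssubset hR ⟨x, by simp⟩
  obtain ⟨f, hf⟩ := h.exists_isColoring_of_ssubset hS (fun _ _ => le_rfl) (h.admissible.mono hS.1)
  have hR' : U \ (U \ {x, y}) = {x, y} := Finset.sdiff_sdiff_eq_self hR
  have hnot : ∀ r ∈ ({x, y} : Finset V), ∀ v ∈ U \ {x, y}, G.Adj v r →
      (if r = x then !f p else !f q) ≠ f v := by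
    intro r hr v hv hvr
    simp only [mem_sdiff, mem_insert, mem_singleton, not_or] at hr hv
    rcases hr with rfl | rfl
    · obtain rfl := (hxn v hv.1 hvr.symm).resolve_left hv.2.2
      simp
    · obtain rfl := (hyn v hv.1 hvr.symm).resolve_left hv.2.1
      simp [hxy.ne']
  refine h.not_glue hS.1 f (fun v => if v = x then !f p else !f q) (fun v hv => ?_) fun v hv => ?_
  · rw [hR', filter_false_of_mem (s := {x, y}) fun r hr hvr => hnot r hr v hv hvr.1 hvr.2]
    simpa using hf v hv
  · rw [hR'] at hv ⊢
    rw [filter_false_of_mem (s := U \ {x, y}) fun u hu hvu =>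
      hnot v hv u hu hvu.1.symm hvu.2.symm]
    refine lt_cond_of_mem_light (U := U) (G := G) ?_ ?_ _
    · simp only [mem_insert, mem_singleton] at hv
      rcases hv with rfl | rfl <;> assumption
    · rw [card_empty, zero_add]
      have : {u ∈ ({x, y} : Finset V) | G.Adj v u ∧ (if u = x then !f p else !f q)
          = if v = x then !f p else !f q} ⊆ ({x, y} : Finset V).erase v := fun u hu => by
        simp only [mem_filter] at hu
        exact mem_erase.2 ⟨hu.2.1.ne', hu.1⟩
      refine (card_le_card this).trans ?_
      rw [card_erase_of_mem hv, card_pair hxy.ne]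

lemma IsMinimal.exists_isColoring_lt (h : IsMinimal G a b U) (hS : S ⊆ U) (hcard : #S + 2 ≤ #U)
    (w : V) : ∃ f : V → Bool, ∀ v ∈ S, #{u ∈ S | G.Adj v u ∧ f u = f v} + (if v = w then 1 else 0)
      < bif f v then a v else b v := by
  have hss : S ⊂ U := by
    refine hS.ssubset_of_ne ?_
    rintro rfl
    omega
  have hupd : ∀ (c : V → ℕ) (v : V),
      Function.update c w (c w - 1) v = c v - if v = w then 1 else 0 := fun c v => by
    rcases eq_or_ne v w with rfl | hv
    · simp
    · simp [hv]
  have hadm : Admissible G (Function.update a w (a w - 1)) (Function.update b w (b w - 1)) S := by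
    refine h.admissible_of_b_ne_zero hS (update_sub_one_le a w) (update_sub_one_le b w)
      (fun v hv => ?_) fun A hA hne => ?_
    · have := h.two_le_b (hS hv)
      rw [hupd]
      split_ifs <;> omega
    · have h1 := h.two_le_potential (hA.trans hS) (by have := card_le_card hA; omega) hne
      have h2 : ∑ v ∈ A, (weight (a v) (b v) - weight (Function.update a w (a w - 1) v)
          (Function.update b w (b w - 1) v)) ≤ ∑ v ∈ A, if v = w then (7 : ℤ) else 0 :=
        sum_le_sum fun v _ => by
          rw [hupd, hupd]
          simp only [weight]
          split_ifs <;> omega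
      rw [sum_ite_eq'] at h2
      split_ifs at h2 <;> linarith
  obtain ⟨f, hf⟩ := h.exists_isColoring_of_ssubset hss (fun v _ => update_sub_one_le b w v) hadm
  refine ⟨f, fun v hv => ?_⟩
  have := hf v hv
  rw [hupd, hupd] at this
  cases hfv : f v <;> simp only [hfv, cond_true, cond_false] at this ⊢ <;> omega

lemma IsMinimal.exists_light_neighbor (h : IsMinimal G a b U) {s : V} (hs : s ∈ U) :
    ∃ t : V → V, ∀ x ∈ light G a b U, G.Adj s x →
      t x ∈ U \ insert s {u ∈ light G a b U | G.Adj s u} ∧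
        ∀ u ∈ U, G.Adj x u → u = s ∨ u = t x := by
  have : ∀ x, ∃ t, x ∈ light G a b U → G.Adj s x →
      t ∈ U \ insert s {u ∈ light G a b U | G.Adj s u} ∧
        ∀ u ∈ U, G.Adj x u → u = s ∨ u = t := fun x => by
    by_cases hx : x ∈ light G a b U ∧ G.Adj s x
    · obtain ⟨t, ht, hts, hxt, hall⟩ := exists_of_mem_light hx.1 hs hx.2.symm
      refine ⟨t, fun _ _ => ⟨?_, hall⟩⟩
      simp only [mem_sdiff, mem_insert, mem_filter, not_or, not_and]
      exact ⟨ht, hts, fun htD => absurd hxt (h.not_adj_of_mem_light hx.1 htD)⟩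
    · exact ⟨s, fun h1 h2 => absurd ⟨h1, h2⟩ hx⟩
  choose t ht using this
  exact ⟨t, ht⟩

/-- The coloring of the rest of the graph that leaves room for one more neighbour of `w` does not
extend to `s` and its light neighbours. -/
lemma IsMinimal.not_extend (h : IsMinimal G a b U) {s w r : V} {f g : V → Bool} {t : V → V}
    {X : Finset V} (hX : X = {u ∈ light G a b U | G.Adj s u}) (hs : s ∈ U)
    (ht : ∀ x ∈ X, t x ∈ U \ insert s X ∧ ∀ u ∈ U, G.Adj x u → u = s ∨ u = t x)
    (hf : ∀ v ∈ U \ insert s X, #{u ∈ U \ insert s X | G.Adj v u ∧ f u = f v}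
      + (if v = w then 1 else 0) < bif f v then a v else b v)
    (hg : ∀ x ∈ X, g x ≠ f (t x) ∨ g x ≠ g s)
    (hr : ∀ v ∈ U \ insert s X, ∀ u ∈ insert s X, G.Adj v u → g u = f v → v = w ∧ u = r)
    (hgs : #{u ∈ U \ insert s X | G.Adj s u ∧ f u = g s} + #{x ∈ X | g x = g s}
      < bif g s then a s else b s) : False := by
  have hXD : X ⊆ light G a b U := hX ▸ filter_subset _ _
  have hR : insert s X ⊆ U := insert_subset hs (hXD.trans (filter_subset _ _))
  have hR' : U \ (U \ insert s X) = insert s X := Finset.sdiff_sdiff_eq_self hR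
  refine h.not_glue (S := U \ insert s X) sdiff_subset f g (fun v hv => ?_) fun v hv => ?_
  · rw [hR']
    have h1 := hf v hv
    by_cases hvw : v = w
    · have h2 : #{u ∈ insert s X | G.Adj v u ∧ g u = f v} ≤ 1 :=
        (card_le_card (t := {r}) fun u hu => by
          simp only [mem_filter] at hu
          exact mem_singleton.2 (hr v hv u hu.1 hu.2.1 hu.2.2).2).trans (card_singleton _).le
      rw [if_pos hvw] at h1
      omega
    · rw [filter_false_of_mem (s := insert s X) fun u hu hvu =>
        hvw (hr v hv u hu hvu.1 hvu.2).1]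
      rw [if_neg hvw] at h1
      exact h1
  · rw [hR'] at hv ⊢
    rcases mem_insert.1 hv with rfl | hvX
    · refine lt_of_le_of_lt (Nat.add_le_add_left (card_le_card fun u hu => ?_) _) hgs
      simp only [mem_filter, mem_insert] at hu ⊢
      exact ⟨hu.1.resolve_left hu.2.1.ne', hu.2.2⟩
    · refine lt_cond_of_mem_light (hXD hvX) ?_ _
      obtain ⟨htv, hall⟩ := ht v hvX
      rw [mem_sdiff] at htv
      have h1 : {u ∈ U \ insert s X | G.Adj v u ∧ f u = g v} ⊆ {t v} := fun u hu => by
        simp only [mem_filter, mem_sdiff] at hu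
        exact mem_singleton.2 ((hall u hu.1.1 hu.2.1).resolve_left fun hus =>
          hu.1.2 (mem_insert.2 (Or.inl hus)))
      have h2 : {u ∈ insert s X | G.Adj v u ∧ g u = g v} ⊆ {s} := fun u hu => by
        simp only [mem_filter] at hu
        exact mem_singleton.2 ((hall u (hR hu.1) hu.2.1).resolve_right fun hut =>
          htv.2 (hut ▸ hu.1))
      rcases hg v hvX with hgv | hgv
      · rw [filter_false_of_mem (s := U \ insert s X) fun u hu hvu => hgv ?_]
        · exact (Nat.zero_add _).le.trans (card_le_card h2)
        · rw [← hvu.2, mem_singleton.1 (h1 (mem_filter.2 ⟨hu, hvu⟩))]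
      · rw [filter_false_of_mem (s := insert s X) fun u hu hvu => hgv ?_]
        · exact card_le_card h1
        · rw [← hvu.2, mem_singleton.1 (h2 (mem_filter.2 ⟨hu, hvu⟩))]

lemma IsMinimal.b_add_one_lt_degIn (h : IsMinimal G a b U) {s w : V} (hs : s ∈ U)
    (hsD : s ∉ light G a b U) (has : a s = 2) (hw : w ∈ U) (hwD : w ∉ light G a b U)
    (hsw : G.Adj s w) (huniq : ∀ u ∈ U, u ∉ light G a b U → G.Adj s u → u = w) :
    b s + 1 < degIn G U s := by
  by_contra! hdeg
  obtain ⟨X, hX⟩ : ∃ X : Finset V, X = {u ∈ light G a b U | G.Adj s u} := ⟨_, rfl⟩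
  have hmemX : ∀ u, u ∈ X ↔ u ∈ light G a b U ∧ G.Adj s u := fun u => by simp [hX]
  obtain ⟨t, ht⟩ := h.exists_light_neighbor hs
  rw [← hX] at ht
  replace ht := fun x hx => ht x ((hmemX x).1 hx).1 ((hmemX x).1 hx).2
  have hXU : X ⊆ U := fun u hu => (mem_filter.1 ((hmemX u).1 hu).1).1
  have hwX : w ∉ X := fun hwX => hwD ((hmemX w).1 hwX).1
  have hsX : s ∉ X := fun hsX => hsD ((hmemX s).1 hsX).1
  have hdegX : degIn G U s = #X + 1 := by
    rw [← card_insert_of_notMem hwX]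
    refine congrArg card (Finset.ext fun u => ?_)
    simp only [mem_filter, mem_insert, hmemX]
    constructor
    · rintro ⟨hu, hsu⟩
      by_cases huD : u ∈ light G a b U
      · exact Or.inr ⟨huD, hsu⟩
      · exact Or.inl (huniq u hu huD hsu)
    · rintro (rfl | ⟨huD, hsu⟩)
      · exact ⟨hw, hsw⟩
      · exact ⟨(mem_filter.1 huD).1, hsu⟩
  have h1 := h.b_lt_degIn hs hsD
  have h2 := h.two_le_b hs
  have hcard : #(U \ insert s X) + 2 ≤ #U := by
    have h3 := card_sdiff_add_card_eq_card (insert_subset hs hXU)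
    rw [card_insert_of_notMem hsX] at h3
    omega
  obtain ⟨f, hf⟩ := h.exists_isColoring_lt sdiff_subset hcard w
  have hS : ∀ v ∈ U \ insert s X, G.Adj s v → v = w := fun v hv hsv => by
    simp only [mem_sdiff, mem_insert, not_or, hmemX] at hv
    exact huniq v hv.1 (fun hvD => hv.2.2 ⟨hvD, hsv⟩) hsv
  obtain ⟨c, hc⟩ : ∃ c, #{u ∈ U \ insert s X | G.Adj s u ∧ f u = c} + #{x ∈ X | (!f (t x)) = c}
      < bif c then a s else b s := by
    by_contra! hlt
    have h3 := hlt true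
    have h4 := hlt false
    have h5 : #{u ∈ U \ insert s X | G.Adj s u ∧ f u = true}
        + #{u ∈ U \ insert s X | G.Adj s u ∧ f u = false} ≤ 1 := by
      rw [← card_union_of_disjoint]
      · refine (card_le_card (t := {w}) fun u hu => ?_).trans (card_singleton _).le
        simp only [mem_union, mem_filter] at hu
        rcases hu with hu | hu <;> exact mem_singleton.2 (hS u hu.1 hu.2.1)
      · refine disjoint_left.2 fun u hu hu' => ?_
        simp only [mem_filter] at hu hu'
        simp [hu.2.2] at hu'
    have h6 := card_filter_add_card_filter_not (s := X) (fun x => (!f (t x)) = true)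
    simp only [Bool.not_eq_true, cond_true, cond_false] at h3 h4 h6
    omega
  refine h.not_extend (g := fun v => if v = s then c else !f (t v)) (r := s) hX hs ht hf
    (fun x hx => ?_) (fun v hv u hu hvu hgu => ?_) ?_
  · have hxs : x ≠ s := fun hxs => hsX (hxs ▸ hx)
    simp [hxs]
  · rcases mem_insert.1 hu with rfl | huX
    · exact ⟨hS v hv hvu.symm, rfl⟩
    · have hus : u ≠ s := fun hus => hsX (hus ▸ huX)
      rw [mem_sdiff] at hv
      have hvt := ((ht u huX).2 v hv.1 hvu.symm).resolve_left fun hvs =>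
        hv.2 (mem_insert.2 (Or.inl hvs))
      simp [hus, hvt] at hgu
  · simp only [if_true]
    rw [filter_congr (s := X) (q := fun x => (!f (t x)) = c) fun x hx => ?_]
    · exact hc
    · have hxs : x ≠ s := fun hxs => hsX (hxs ▸ hx)
      simp [hxs]

lemma IsMinimal.b_add_two_lt_degIn (h : IsMinimal G a b U) {s : V} (hs : s ∈ U)
    (hsD : s ∉ light G a b U) (has : a s = 2) (hall : ∀ u ∈ U, G.Adj s u → u ∈ light G a b U) :
    b s + 2 < degIn G U s := by
  by_contra! hdeg
  obtain ⟨X, hX⟩ : ∃ X : Finset V, X = {u ∈ light G a b U | G.Adj s u} := ⟨_, rfl⟩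
  have hmemX : ∀ u, u ∈ X ↔ u ∈ light G a b U ∧ G.Adj s u := fun u => by simp [hX]
  obtain ⟨t, ht⟩ := h.exists_light_neighbor hs
  rw [← hX] at ht
  replace ht := fun x hx => ht x ((hmemX x).1 hx).1 ((hmemX x).1 hx).2
  have hXU : X ⊆ U := fun u hu => (mem_filter.1 ((hmemX u).1 hu).1).1
  have hsX : s ∉ X := fun hsX => hsD ((hmemX s).1 hsX).1
  have hdegX : degIn G U s = #X := by
    refine congrArg card (Finset.ext fun u => ?_)
    simp only [mem_filter, hmemX]
    exact ⟨fun hu => ⟨hall u hu.1 hu.2, hu.2⟩, fun hu => ⟨(mem_filter.1 hu.1).1, hu.2⟩⟩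
  have h1 := h.b_lt_degIn hs hsD
  have h2 := h.two_le_b hs
  have hcard : #(U \ insert s X) + 2 ≤ #U := by
    have h3 := card_sdiff_add_card_eq_card (insert_subset hs hXU)
    rw [card_insert_of_notMem hsX] at h3
    omega
  obtain ⟨y, hy⟩ := card_pos.1 (show 0 < #X by omega)
  have hys : y ≠ s := fun hys => hsX (hys ▸ hy)
  obtain ⟨f, hf⟩ := h.exists_isColoring_lt sdiff_subset hcard (t y)
  have hS : ∀ v ∈ U \ insert s X, ¬ G.Adj s v := fun v hv hsv => by
    simp only [mem_sdiff, mem_insert, not_or, hmemX] at hv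
    exact hv.2.2 ⟨hall v hv.1 hsv, hsv⟩
  obtain ⟨c, hc⟩ : ∃ c, #{x ∈ X.erase y | (!f (t x)) = c} < bif c then a s else b s := by
    by_contra! hlt
    have h3 := hlt true
    have h4 := hlt false
    have h6 := card_filter_add_card_filter_not (s := X.erase y) (fun x => (!f (t x)) = true)
    rw [card_erase_of_mem hy] at h6
    simp only [Bool.not_eq_true, cond_true, cond_false] at h3 h4 h6
    omega
  refine h.not_extend (g := fun v => if v = s then c else if v = y then !c else !f (t v)) (r := y)
    hX hs ht hf (fun x hx => ?_) (fun v hv u hu hvu hgu => ?_) ?_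
  · have hxs : x ≠ s := fun hxs => hsX (hxs ▸ hx)
    by_cases hxy : x = y <;> simp [hxs, hxy, hys]
  · rcases mem_insert.1 hu with rfl | huX
    · exact absurd hvu.symm (hS v hv)
    · have hus : u ≠ s := fun hus => hsX (hus ▸ huX)
      rw [mem_sdiff] at hv
      have hvt := ((ht u huX).2 v hv.1 hvu.symm).resolve_left fun hvs =>
        hv.2 (mem_insert.2 (Or.inl hvs))
      by_cases huy : u = y
      · exact ⟨huy ▸ hvt, huy⟩
      · simp [hus, huy, hvt] at hgu
  · rw [filter_false_of_mem (s := U \ insert s X) fun u hu hsu => hS u hu hsu.1, card_empty,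
      zero_add]
    simp only [if_true]
    refine (card_le_card fun x hx => ?_).trans_lt hc
    rw [mem_filter] at hx ⊢
    have hxs : x ≠ s := fun hxs => hsX (hxs ▸ hx.1)
    have hxy : x ≠ y := fun hxy => by simp [hxy, hys] at hx
    simp only [if_neg hxs, if_neg hxy] at hx
    exact ⟨mem_erase.2 ⟨hxy, hx.1⟩, hx.2⟩

/-! ### Discharging -/

lemma sum_degIn_comm (S A : Finset V) : ∑ v ∈ A, degIn G S v = ∑ v ∈ S, degIn G A v := by
  unfold degIn
  simp only [card_filter]
  rw [sum_comm]
  simp only [G.adj_comm]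

/-- The charge of a vertex that is not light, after each light vertex has taken `5` from both of
its neighbours. -/
noncomputable def charge (G : SimpleGraph V) (a b : V → ℕ) (U : Finset V) (v : V) : ℤ :=
  4 * degIn G U v + 5 * degIn G (U \ light G a b U) v - 2 * weight (a v) (b v)

lemma light_subset : light G a b U ⊆ U := filter_subset _ _

lemma degIn_sdiff_light_add (v : V) :
    degIn G (U \ light G a b U) v + degIn G (light G a b U) v = degIn G U v := by
  rw [← degIn_union sdiff_disjoint, sdiff_union_of_subset light_subset]

lemma IsMinimal.sum_charge_le (h : IsMinimal G a b U) :
    ∑ v ∈ U \ light G a b U, charge G a b U v ≤ 10 := by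
  have h0 := h.two_lt_card
  have h1 := h.admissible.le_potential U Subset.rfl (card_pos.1 (by omega))
  have h2 := two_mul_edgesIn (G := G) U
  have hlight : ∀ v ∈ light G a b U, degIn G (U \ light G a b U) v = 2 := fun v hv => by
    rw [← (mem_filter.1 hv).2.2.2, ← degIn_sdiff_light_add (a := a) (b := b) (U := U) v,
      Nat.left_eq_add]
    exact card_eq_zero.2 (filter_eq_empty_iff.2 fun u hu => h.not_adj_of_mem_light hv hu)
  have h3 : ∑ v ∈ U \ light G a b U, (degIn G (light G a b U) v : ℤ) = 2 * #(light G a b U) := by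
    rw [← Nat.cast_sum, sum_degIn_comm, sum_congr rfl hlight]
    simp [mul_comm]
  have h4 : ∑ v ∈ light G a b U, (9 * (degIn G U v : ℤ) - 2 * weight (a v) (b v))
      = -10 * #(light G a b U) := by
    rw [sum_congr rfl (g := fun _ => -10) fun v hv => ?_]
    · simp [mul_comm]
    · obtain ⟨-, h5, h6, h7⟩ := mem_filter.1 hv
      simp [h5, h6, h7, weight]
  have h5 : ∑ v ∈ U \ light G a b U, charge G a b U v
      = ∑ v ∈ U \ light G a b U, (9 * (degIn G U v : ℤ) - 2 * weight (a v) (b v))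
        - 5 * ∑ v ∈ U \ light G a b U, (degIn G (light G a b U) v : ℤ) := by
    rw [mul_sum, ← sum_sub_distrib]
    refine sum_congr rfl fun v _ => ?_
    have := degIn_sdiff_light_add (G := G) (a := a) (b := b) (U := U) v
    unfold charge
    omega
  have h6 := sum_sdiff (f := fun v => 9 * (degIn G U v : ℤ) - 2 * weight (a v) (b v))
    (light_subset (G := G) (a := a) (b := b) (U := U))
  have h7 : ∑ v ∈ U, (9 * (degIn G U v : ℤ) - 2 * weight (a v) (b v))
      = -2 * potential G a b U := by
    rw [sum_sub_distrib, ← mul_sum, ← mul_sum, ← Nat.cast_sum, ← h2]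
    unfold potential
    push_cast
    ring
  linarith

lemma IsMinimal.charge_pos (h : IsMinimal G a b U) {v : V} (hv : v ∈ U \ light G a b U)
    (hm : degIn G (U \ light G a b U) v ≠ 0) : 0 < charge G a b U v := by
  obtain ⟨hvU, hvD⟩ := mem_sdiff.1 hv
  have h1 := h.b_lt_degIn hvU hvD
  have h2 := h.two_le_b hvU
  have h3 := h.admissible.b_le v hvU
  have h4 := h.admissible.a_le v hvU
  by_cases hm1 : a v = 2 ∧ degIn G (U \ light G a b U) v = 1
  · obtain ⟨w, hw⟩ := card_eq_one.1 hm1.2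
    have hmem : ∀ u, (u ∈ U ∧ u ∉ light G a b U) ∧ G.Adj v u ↔ u = w := fun u => by
      rw [← mem_sdiff, ← mem_filter, hw, mem_singleton]
    have hw' := (hmem w).2 rfl
    have := h.b_add_one_lt_degIn hvU hvD hm1.1 hw'.1.1 hw'.1.2 hw'.2
      fun u hu huD hvu => (hmem u).1 ⟨⟨hu, huD⟩, hvu⟩
    unfold charge weight
    omega
  · unfold charge weight
    omega

lemma IsMinimal.charge_nonneg (h : IsMinimal G a b U) {v : V} (hv : v ∈ U \ light G a b U) :
    0 ≤ charge G a b U v := by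
  by_cases hm : degIn G (U \ light G a b U) v = 0
  · obtain ⟨hvU, hvD⟩ := mem_sdiff.1 hv
    have h1 := h.b_lt_degIn hvU hvD
    have h2 := h.two_le_b hvU
    have h3 := h.admissible.b_le v hvU
    have h4 := h.admissible.a_le v hvU
    by_cases ha : a v = 2
    · have := h.b_add_two_lt_degIn hvU hvD ha fun u hu hvu => by
        by_contra huD
        exact filter_eq_empty_iff.1 (card_eq_zero.1 hm) (mem_sdiff.2 ⟨hu, huD⟩) hvu
      unfold charge weight
      omega
    · unfold charge weight
      omega
  · exact (h.charge_pos hv hm).le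

lemma IsMinimal.sum_charge_le_of_subset (h : IsMinimal G a b U) (hA : A ⊆ U \ light G a b U) :
    ∑ v ∈ A, charge G a b U v ≤ 10 :=
  (sum_le_sum_of_subset_of_nonneg hA fun _ hv _ => h.charge_nonneg hv).trans h.sum_charge_le

/-- The vertices that cannot be colored `false` together with all other vertices that are not
light. -/
noncomputable def crowded (G : SimpleGraph V) (a b : V → ℕ) (U : Finset V) : Finset V :=
  {v ∈ U \ light G a b U | b v ≤ degIn G (U \ light G a b U) v}

lemma IsMinimal.six_le_charge (h : IsMinimal G a b U) {v : V} (hv : v ∈ crowded G a b U) :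
    6 ≤ charge G a b U v := by
  obtain ⟨hvD, hbv⟩ := mem_filter.1 hv
  obtain ⟨hvU, hvD⟩ := mem_sdiff.1 hvD
  have h1 := h.b_lt_degIn hvU hvD
  have h2 := h.two_le_b hvU
  have h3 := h.admissible.b_le v hvU
  have h4 := h.admissible.a_le v hvU
  unfold charge weight
  omega

lemma IsMinimal.eq_of_mem_crowded (h : IsMinimal G a b U) {v w : V} (hv : v ∈ crowded G a b U)
    (hw : w ∈ crowded G a b U) : v = w := by
  by_contra hvw
  have h1 := h.sum_charge_le_of_subset (A := {v, w})
    (insert_subset (mem_filter.1 hv).1 (singleton_subset_iff.2 (mem_filter.1 hw).1))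
  rw [sum_pair hvw] at h1
  have h2 := h.six_le_charge hv
  have h3 := h.six_le_charge hw
  omega

lemma IsMinimal.degIn_light_lt (h : IsMinimal G a b U) {v : V} (hv : v ∈ crowded G a b U) :
    degIn G (light G a b U) v < a v := by
  obtain ⟨hvD', hbv⟩ := mem_filter.1 hv
  obtain ⟨hvU, hvD⟩ := mem_sdiff.1 hvD'
  have h1 := h.b_lt_degIn hvU hvD
  have h2 := h.two_le_b hvU
  have h3 := h.admissible.b_le v hvU
  have h4 := h.admissible.a_le v hvU
  have h5 := degIn_sdiff_light_add (G := G) (a := a) (b := b) (U := U) v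
  obtain ⟨u, hu⟩ := card_pos.1 (show 0 < degIn G (U \ light G a b U) v by omega)
  rw [mem_filter] at hu
  have h6 := h.charge_pos hu.1 (card_ne_zero_of_mem (mem_filter.2 ⟨hvD', hu.2.symm⟩))
  have h7 := h.sum_charge_le_of_subset (A := {v, u})
    (insert_subset hvD' (singleton_subset_iff.2 hu.1))
  rw [sum_pair hu.2.ne] at h7
  have h8 : charge G a b U v ≤ 9 := by linarith
  unfold charge weight at h8
  omega

lemma IsMinimal.false (h : IsMinimal G a b U) : False := by
  refine h.not_isColoring (fun v => decide (v ∈ light G a b U ∨ v ∈ crowded G a b U))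
    fun v hv => ?_
  by_cases hvD : v ∈ light G a b U
  · refine lt_cond_of_mem_light hvD (card_le_one.2 fun u hu w hw => ?_) _
    have key : ∀ u ∈ U, G.Adj v u → decide (u ∈ light G a b U ∨ u ∈ crowded G a b U)
        = decide (v ∈ light G a b U ∨ v ∈ crowded G a b U) → u ∈ crowded G a b U := by
      intro u _ hvu hdec
      simp only [hvD, true_or, decide_true, decide_eq_true_eq] at hdec
      exact hdec.resolve_left fun huD => h.not_adj_of_mem_light hvD huD hvu
    rw [mem_filter] at hu hw
    exact h.eq_of_mem_crowded (key u hu.1 hu.2.1 hu.2.2) (key w hw.1 hw.2.1 hw.2.2)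
  · by_cases hvC : v ∈ crowded G a b U
    · simp only [hvC, or_true, decide_true, cond_true, decide_eq_true_eq]
      refine (card_le_card fun u hu => ?_).trans_lt (h.degIn_light_lt hvC)
      simp only [mem_filter] at hu ⊢
      exact ⟨hu.2.2.resolve_right fun huC => hu.2.1.ne (h.eq_of_mem_crowded hvC huC), hu.2.1⟩
    · have hlt : degIn G (U \ light G a b U) v < b v := by
        by_contra! hle
        exact hvC (mem_filter.2 ⟨mem_sdiff.2 ⟨hv, hvD⟩, hle⟩)
      simp only [hvD, hvC, or_self, decide_false, cond_false, decide_eq_false_iff_not]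
      refine (card_le_card fun u hu => ?_).trans_lt hlt
      simp only [mem_filter, mem_sdiff, not_or] at hu ⊢
      exact ⟨⟨hu.1, hu.2.2.1⟩, hu.2.1⟩

theorem Admissible.exists_isColoring (h : Admissible G a b S) : ∃ f, IsColoring G a b S f := by
  obtain ⟨n, hn⟩ : ∃ n, size G b S = n := ⟨_, rfl⟩
  induction n using Nat.strong_induction_on generalizing G a b S with
  | _ n ih =>
    by_contra! hnot
    exact IsMinimal.false ⟨h, hnot, fun G' a' b' S' hlt hadm => ih _ (hn ▸ hlt) hadm rfl⟩

/-! ### Subgraphs -/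

lemma exists_subgraph [Fintype V] (G : SimpleGraph V) (A : Finset V) :
    ∃ H : G.Subgraph, H.verts.ncard = #A ∧ H.edgeSet.ncard = edgesIn G A := by
  refine ⟨(⊤ : G.Subgraph).induce A, by simp, ?_⟩
  set H := ((⊤ : G.Subgraph).induce A).spanningCoe with hH
  have hadj : ∀ u v, H.Adj u v ↔ u ∈ A ∧ v ∈ A ∧ G.Adj u v := fun u v => by simp [hH]
  have h1 := H.sum_degrees_eq_twice_card_edges
  have hdeg : ∀ v, H.degree v = if v ∈ A then degIn G A v else 0 := fun v => by
    rw [← SimpleGraph.card_neighborFinset_eq_degree]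
    split_ifs with hv
    · refine congrArg card (Finset.ext fun u => ?_)
      simp [hadj, hv]
    · refine card_eq_zero.2 (eq_empty_iff_forall_notMem.2 fun u => ?_)
      simp [hadj, hv]
  simp only [hdeg] at h1
  rw [sum_ite_mem, univ_inter, ← two_mul_edgesIn] at h1
  have h2 : ((⊤ : G.Subgraph).induce A).edgeSet = H.edgeSet := by
    simp [hH]
  rw [h2, ← SimpleGraph.coe_edgeFinset, Set.ncard_coe_finset]
  omega

lemma card_filter_eq_ncard [Fintype V] (G : SimpleGraph V) (f : V → Bool) (v : V) (c : Bool) :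
    #{u ∈ univ | G.Adj v u ∧ f u = c} = (G.neighborSet v ∩ {u | f u = c}).ncard := by
  rw [← Set.ncard_coe_finset]
  congr 1
  ext u
  simp

end DefectiveColoring

/-- If every subgraph H of G satisfies |E(H)| ≤ (14|V(H)| + 5)/9, then G is (1,3)-colorable. -/
theorem stmt3 {V : Type*} [Fintype V] (G : SimpleGraph V)
    (h : ∀ H : G.Subgraph, 9 * H.edgeSet.ncard ≤ 14 * H.verts.ncard + 5) :
    Colorable13 G := by
  have hadm : DefectiveColoring.Admissible G (fun _ => 2) (fun _ => 4) Finset.univ := by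
    refine ⟨fun _ _ => le_rfl, fun _ _ => le_rfl, fun A _ _ => ?_, fun _ _ h4 => by simp at h4⟩
    obtain ⟨H, hV, hE⟩ := DefectiveColoring.exists_subgraph G A
    have hH := h H
    simp only [DefectiveColoring.potential, DefectiveColoring.weight, Finset.sum_const, hV, hE,
      nsmul_eq_mul] at hH ⊢
    push_cast
    norm_num
    omega
  obtain ⟨f, hf⟩ := hadm.exists_isColoring
  refine ⟨f, fun v hv => ?_, fun v hv => ?_⟩
  · have := hf v (Finset.mem_univ v)
    rw [DefectiveColoring.card_filter_eq_ncard, hv] at this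
    exact Nat.le_of_lt_succ this
  · have := hf v (Finset.mem_univ v)
    rw [DefectiveColoring.card_filter_eq_ncard, hv] at this
    exact Nat.le_of_lt_succ this
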